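/- Let ℓ > 0, 1 < p < ∞, γ : ℝ → ℝ continuous, strictly increasing and surjective with γ(0) = 0, f ∈ L^1(0,ℓ) and a, b ∈ ℝ. For ε ∈ ℝ, let v_ε = γ ∘ u_ε denote the weak solution of (P^{γ,f}_{p,a−ε,b+ε}), with u_ε its C¹ representative. Then: (i) for ε > 0 one has u_ε(ℓ) > u_0(ℓ) and u_ε(0) < u_0(0), and for ε < 0 one has u_ε(ℓ) < u_0(ℓ) and u_ε(0) > u_0(0); (ii) the maps ε ↦ u_ε(ℓ) and ε ↦ u_ε(0) are continuous on ℝ. -/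

import Mathlib

open MeasureTheory Set Filter

noncomputable section

/-- A connected compact metric graph: finite nonempty vertex set, finite edge set,
initial/terminal vertex maps without loops, positive edge lengths, no multiple edges,
and connectedness via paths of edges. -/
structure MetricGraph where
  V : Type
  E : Type
  fintypeV : Fintype V
  fintypeE : Fintype E
  nonemptyV : Nonempty V
  ι : E → V
  τ : E → V
  no_loops : ∀ e, ι e ≠ τ e
  len : E → ℝ
  len_pos : ∀ e, 0 < len e
  no_multi : ∀ e e', ({ι e, τ e} : Set V) = ({ι e', τ e'} : Set V) → e = e'
  connected : ∀ v w : V,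
    Relation.ReflTransGen (fun a b => ∃ e, (ι e = a ∧ τ e = b) ∨ (ι e = b ∧ τ e = a)) v w

/-- Sum over the edges of the graph. -/
def edgeSum (G : MetricGraph) (F : G.E → ℝ) : ℝ :=
  letI := G.fintypeE
  ∑ e, F e

/-- Sum over the vertices of the graph. -/
def vertexSum (G : MetricGraph) (F : G.V → ℝ) : ℝ :=
  letI := G.fintypeV
  ∑ v, F v

/-- Number of vertices. -/
def vertexCard (G : MetricGraph) : ℕ :=
  letI := G.fintypeV
  Fintype.card G.V

/-- ρ_p(r) = |r|^(p-2) r. -/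
def rho (p r : ℝ) : ℝ := |r| ^ (p - 2) * r

/-- `(u, u')` is in the Sobolev space W^{1,p}(0,ℓ): `u'` is integrable with `|u'|^p`
integrable on (0,ℓ), and `u` is absolutely continuous on [0,ℓ] with derivative `u'`. -/
def IntervalSobolev (ℓ p : ℝ) (u u' : ℝ → ℝ) : Prop :=
  IntegrableOn u' (Ioo 0 ℓ) volume ∧
  IntegrableOn (fun x => |u' x| ^ p) (Ioo 0 ℓ) volume ∧
  ∀ x ∈ Icc (0:ℝ) ℓ, u x = u 0 + ∫ t in (0:ℝ)..x, u' t

/-- `(u, u')` is in W^{1,p̄}(G), continuous at the vertices with vertex values `uV`. -/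
def GraphSobolev (G : MetricGraph) (p : G.E → ℝ) (u u' : G.E → ℝ → ℝ) (uV : G.V → ℝ) : Prop :=
  (∀ e, IntervalSobolev (G.len e) (p e) (u e) (u' e)) ∧
  (∀ e, u e 0 = uV (G.ι e)) ∧
  (∀ e, u e (G.len e) = uV (G.τ e))

/-- `v` is a weak solution of the graph problem (P_ω^f) with data `u, u', uV`. -/
def SolvesGraphProblem (G : MetricGraph) (p : G.E → ℝ) (γ : G.E → ℝ → ℝ)
    (f : G.E → ℝ → ℝ) (ω : G.V → ℝ)
    (v : G.E → ℝ → ℝ) (u u' : G.E → ℝ → ℝ) (uV : G.V → ℝ) : Prop :=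
  (∀ e, IntegrableOn (v e) (Ioo 0 (G.len e)) volume) ∧
  GraphSobolev G p u u' uV ∧
  (∀ e, ∀ᵐ x ∂(volume.restrict (Ioo 0 (G.len e))), v e x = γ e (u e x)) ∧
  ∀ φ φ' : G.E → ℝ → ℝ, ∀ φV : G.V → ℝ, GraphSobolev G p φ φ' φV →
    edgeSum G (fun e => ∫ x in Ioo 0 (G.len e), v e x * φ e x)
      + edgeSum G (fun e => ∫ x in Ioo 0 (G.len e), rho (p e) (u' e x) * φ' e x)
    = edgeSum G (fun e => ∫ x in Ioo 0 (G.len e), f e x * φ e x)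
      + vertexSum G (fun w => ω w * φV w)

/-- `v` is a weak solution of the graph problem (P_ω^f). -/
def IsGraphWeakSolution (G : MetricGraph) (p : G.E → ℝ) (γ : G.E → ℝ → ℝ)
    (f : G.E → ℝ → ℝ) (ω : G.V → ℝ) (v : G.E → ℝ → ℝ) : Prop :=
  ∃ u u' uV, SolvesGraphProblem G p γ f ω v u u' uV

/-- `v` is a weak solution of the interval Neumann problem (P^{γ,f}_{p,a,b}),
with associated Sobolev function `u` (derivative `u'`). -/
def SolvesNeumann (ℓ p : ℝ) (γ f : ℝ → ℝ) (a b : ℝ) (v u u' : ℝ → ℝ) : Prop :=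
  IntegrableOn v (Ioo 0 ℓ) volume ∧
  IntervalSobolev ℓ p u u' ∧
  (∀ᵐ x ∂(volume.restrict (Ioo 0 ℓ)), v x = γ (u x)) ∧
  ∀ φ φ' : ℝ → ℝ, IntervalSobolev ℓ p φ φ' →
    (∫ x in Ioo 0 ℓ, v x * φ x) + (∫ x in Ioo 0 ℓ, rho p (u' x) * φ' x)
    = (∫ x in Ioo 0 ℓ, f x * φ x) + a * φ 0 + b * φ ℓ

/-- `v` is a weak solution of the interval Neumann problem (P^{γ,f}_{p,a,b}). -/
def IsNeumannWeakSolution (ℓ p : ℝ) (γ f : ℝ → ℝ) (a b : ℝ) (v : ℝ → ℝ) : Prop :=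
  ∃ u u', SolvesNeumann ℓ p γ f a b v u u'

end

lemma rho_eq_max {p : ℝ} (hp : 1 < p) (r : ℝ) :
    rho p r = (max r 0) ^ (p - 1) - (max (-r) 0) ^ (p - 1) := by
  have hp0 : p - 1 ≠ 0 := by linarith
  unfold rho
  rcases lt_trichotomy r 0 with h | h | h
  · rw [max_eq_right h.le, max_eq_left (by linarith), Real.zero_rpow hp0, abs_of_neg h,
      show p - 1 = (p - 2) + 1 by ring, Real.rpow_add_one (by linarith)]
    ring
  · subst h
    simp
  · rw [max_eq_left h.le, max_eq_right (by linarith), Real.zero_rpow hp0, abs_of_pos h,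
      show p - 1 = (p - 2) + 1 by ring, Real.rpow_add_one (by linarith)]
    ring

lemma continuous_rho {p : ℝ} (hp : 1 < p) : Continuous (rho p) := by
  rw [show rho p = fun r => (max r 0) ^ (p - 1) - (max (-r) 0) ^ (p - 1) from
    funext (rho_eq_max hp)]
  have h : 0 ≤ p - 1 := by linarith
  exact ((continuous_id.max continuous_const).rpow_const fun _ => Or.inr h).sub
    ((continuous_neg.max continuous_const).rpow_const fun _ => Or.inr h)

lemma strictMono_rho {p : ℝ} (hp : 1 < p) : StrictMono (rho p) := by
  intro r s hrs
  have h : 0 < p - 1 := by linarith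
  rw [rho_eq_max hp, rho_eq_max hp]
  have h1 : (max r 0) ^ (p - 1) ≤ (max s 0) ^ (p - 1) :=
    Real.rpow_le_rpow (le_max_right _ _) (max_le_max_right 0 hrs.le) h.le
  have h2 : (max (-s) 0) ^ (p - 1) ≤ (max (-r) 0) ^ (p - 1) :=
    Real.rpow_le_rpow (le_max_right _ _) (max_le_max_right 0 (by linarith)) h.le
  rcases lt_or_ge 0 s with hs | hs
  · have : (max r 0) ^ (p - 1) < (max s 0) ^ (p - 1) :=
      Real.rpow_lt_rpow (le_max_right _ _)
        (by rw [max_eq_left hs.le]; exact max_lt hrs hs) h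
    linarith
  · have : (max (-s) 0) ^ (p - 1) < (max (-r) 0) ^ (p - 1) :=
      Real.rpow_lt_rpow (le_max_right _ _)
        (by rw [max_eq_left (by linarith : 0 ≤ -s), max_eq_left (by linarith : 0 ≤ -r)]
            linarith) h
    linarith

/-- If `w' = d`, `z' = h`, where `d > 0` as soon as `z > 0` and `h > 0` as soon as `w > 0`, then
`z` stays above a positive value taken at a point where `w` is nonnegative. -/
lemma lt_of_cooperative_right {ℓ : ℝ} {w z d h : ℝ → ℝ}
    (hd : ContinuousOn d (Icc 0 ℓ)) (hh : ContinuousOn h (Icc 0 ℓ)) (hz : ContinuousOn z (Icc 0 ℓ))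
    (hwd : ∀ x ∈ Icc 0 ℓ, ∀ y ∈ Icc 0 ℓ, w y - w x = ∫ t in x..y, d t)
    (hzh : ∀ x ∈ Icc 0 ℓ, ∀ y ∈ Icc 0 ℓ, z y - z x = ∫ t in x..y, h t)
    (hdz : ∀ x ∈ Icc 0 ℓ, 0 < z x → 0 < d x) (hhw : ∀ x ∈ Icc 0 ℓ, 0 < w x → 0 < h x)
    {x y : ℝ} (hx : 0 ≤ x) (hxy : x < y) (hy : y ≤ ℓ) (hzx : 0 < z x) (hwx : 0 ≤ w x) :
    z x < z y := by
  have key : ∀ s, x < s → s ≤ ℓ → (∀ t ∈ Ico x s, 0 < z t) → z x < z s := by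
    intro s hxs hs hpos
    have hsub : ∀ c, c ≤ s → ∀ t ∈ Icc x c, t ∈ Icc 0 ℓ := fun c hc t ht =>
      ⟨hx.trans ht.1, ht.2.trans (hc.trans hs)⟩
    have hint : ∀ g : ℝ → ℝ, ContinuousOn g (Icc 0 ℓ) → ∀ c, x ≤ c → c ≤ s →
        IntervalIntegrable g volume x c := fun g hg c hxc hc =>
      (hg.mono (by rw [uIcc_of_le hxc]; exact hsub c hc)).intervalIntegrable
    have hw : ∀ t ∈ Ioo x s, 0 < w t := by
      intro t ht
      have h1 := intervalIntegral.intervalIntegral_pos_of_pos_on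
        (hint d hd t ht.1.le ht.2.le)
        (fun r hr => hdz r (hsub s le_rfl r ⟨hr.1.le, (hr.2.trans ht.2).le⟩)
          (hpos r ⟨hr.1.le, hr.2.trans ht.2⟩)) ht.1
      have h2 := hwd x (hsub s le_rfl x ⟨le_rfl, hxs.le⟩) t (hsub s le_rfl t ⟨ht.1.le, ht.2.le⟩)
      linarith
    have h1 := intervalIntegral.intervalIntegral_pos_of_pos_on
      (hint h hh s hxs.le le_rfl)
      (fun r hr => hhw r (hsub s le_rfl r ⟨hr.1.le, hr.2.le⟩) (hw r hr)) hxs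
    have h2 := hzh x (hsub s le_rfl x ⟨le_rfl, hxs.le⟩) s (hsub s le_rfl s ⟨hxs.le, le_rfl⟩)
    linarith
  have hpos : ∀ t ∈ Icc x y, 0 < z t := by
    by_contra! hcon
    obtain ⟨t, ht, hzt⟩ := hcon
    have hc : IsCompact (Icc x y ∩ z ⁻¹' Iic 0) :=
      isCompact_Icc.of_isClosed_subset
        ((hz.mono (Icc_subset_Icc hx hy)).preimage_isClosed_of_isClosed isClosed_Icc isClosed_Iic)
        inter_subset_left
    obtain ⟨s, ⟨hs, hzs⟩, hmin⟩ := hc.exists_isLeast ⟨t, ht, hzt⟩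
    have hzs : z s ≤ 0 := hzs
    have hxs : x < s := lt_of_le_of_ne hs.1 (by rintro rfl; linarith)
    have := key s hxs (hs.2.trans hy) (by
      intro r hr
      by_contra! hr0
      exact absurd (hmin ⟨⟨hr.1, hr.2.le.trans hs.2⟩, hr0⟩) (not_le.2 hr.2))
    linarith
  exact key y hxy hy fun t ht => hpos t ⟨ht.1, ht.2.le⟩

/-- Mirror image of `lt_of_cooperative_right`. -/
lemma lt_of_cooperative_left {ℓ : ℝ} {w z d h : ℝ → ℝ}
    (hd : ContinuousOn d (Icc 0 ℓ)) (hh : ContinuousOn h (Icc 0 ℓ)) (hz : ContinuousOn z (Icc 0 ℓ))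
    (hwd : ∀ x ∈ Icc 0 ℓ, ∀ y ∈ Icc 0 ℓ, w y - w x = ∫ t in x..y, d t)
    (hzh : ∀ x ∈ Icc 0 ℓ, ∀ y ∈ Icc 0 ℓ, z y - z x = ∫ t in x..y, h t)
    (hdz : ∀ x ∈ Icc 0 ℓ, 0 < z x → 0 < d x) (hhw : ∀ x ∈ Icc 0 ℓ, w x < 0 → h x < 0)
    {x y : ℝ} (hx : 0 ≤ x) (hxy : x < y) (hy : y ≤ ℓ) (hzy : 0 < z y) (hwy : w y ≤ 0) :
    z y < z x := by
  have hr : ∀ t ∈ Icc 0 ℓ, ℓ - t ∈ Icc 0 ℓ := fun t ht => ⟨by linarith [ht.2], by linarith [ht.1]⟩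
  have hrc : ContinuousOn (fun t => ℓ - t) (Icc 0 ℓ) := (continuous_const.sub continuous_id).continuousOn
  have := lt_of_cooperative_right (ℓ := ℓ) (w := fun t => -w (ℓ - t)) (z := fun t => z (ℓ - t))
    (d := fun t => d (ℓ - t)) (h := fun t => -h (ℓ - t)) (hd.comp hrc hr) (hh.comp hrc hr).neg
    (hz.comp hrc hr)
    (fun s hs t ht => by
      rw [intervalIntegral.integral_comp_sub_left, ← hwd _ (hr t ht) _ (hr s hs)]
      ring)
    (fun s hs t ht => by
      rw [intervalIntegral.integral_neg, intervalIntegral.integral_comp_sub_left,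
        ← hzh _ (hr t ht) _ (hr s hs)]
      ring)
    (fun t ht h0 => hdz _ (hr t ht) h0)
    (fun t ht h0 => by linarith [hhw _ (hr t ht) (by linarith)])
    (x := ℓ - y) (y := ℓ - x) (by linarith) (by linarith) (by linarith)
    (by simpa using hzy) (by simpa using hwy)
  simpa using this

lemma intervalSobolev_primitive {ℓ p : ℝ} (hp : 0 ≤ p) (c : ℝ) {g : ℝ → ℝ} (hg : Continuous g) :
    IntervalSobolev ℓ p (fun x => c + ∫ t in (0 : ℝ)..x, g t) g := by
  refine ⟨?_, ?_, fun x _ => by simp⟩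
  · exact (hg.integrableOn_Icc).mono_set Ioo_subset_Icc_self
  · exact ((hg.abs.rpow_const fun _ => Or.inr hp).integrableOn_Icc).mono_set Ioo_subset_Icc_self

lemma integral_Ioo_eq_interval {ℓ : ℝ} (hℓ : 0 ≤ ℓ) (g : ℝ → ℝ) :
    ∫ x in Ioo 0 ℓ, g x = ∫ x in (0 : ℝ)..ℓ, g x := by
  rw [intervalIntegral.integral_of_le hℓ, integral_Ioc_eq_integral_Ioo]

/-- Du Bois-Reymond lemma: the weak formulation with right-hand side `η (φ ℓ - φ 0)` yields the
pointwise equation `z' = h`, `z 0 = η`, `z ℓ = η`. -/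
lemma eq_add_integral_of_weak {ℓ η : ℝ} (hℓ : 0 < ℓ) {z h : ℝ → ℝ}
    (hz : ContinuousOn z (Icc 0 ℓ)) (hh : ContinuousOn h (Icc 0 ℓ))
    (hweak : ∀ (c : ℝ) (g : ℝ → ℝ), Continuous g →
      (∫ x in (0 : ℝ)..ℓ, h x * (c + ∫ t in (0 : ℝ)..x, g t)) + (∫ x in (0 : ℝ)..ℓ, z x * g x)
        = η * ∫ t in (0 : ℝ)..ℓ, g t) :
    (∀ x ∈ Icc 0 ℓ, z x = η + ∫ t in (0 : ℝ)..x, h t) ∧ z ℓ = η := by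
  obtain ⟨zc, hzc, hzeq⟩ : ∃ zc : ℝ → ℝ, Continuous zc ∧ EqOn z zc (Icc 0 ℓ) :=
    ⟨IccExtend hℓ.le (domRestrict (Icc 0 ℓ) z), (continuousOn_iff_continuous_domRestrict.1 hz).Icc_extend',
      fun x hx => by rw [IccExtend_of_mem _ _ hx]; rfl⟩
  obtain ⟨hc, hhc, hheq⟩ : ∃ hc : ℝ → ℝ, Continuous hc ∧ EqOn h hc (Icc 0 ℓ) :=
    ⟨IccExtend hℓ.le (domRestrict (Icc 0 ℓ) h), (continuousOn_iff_continuous_domRestrict.1 hh).Icc_extend',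
      fun x hx => by rw [IccExtend_of_mem _ _ hx]; rfl⟩
  have hsub : ∀ x ∈ Icc 0 ℓ, uIcc 0 x ⊆ Icc 0 ℓ := fun x hx => by
    rw [uIcc_of_le hx.1]; exact Icc_subset_Icc le_rfl hx.2
  have hℓm : ℓ ∈ Icc 0 ℓ := ⟨hℓ.le, le_rfl⟩
  have hHeq : ∀ x ∈ Icc 0 ℓ, ∫ t in (0 : ℝ)..x, h t = ∫ t in (0 : ℝ)..x, hc t := fun x hx =>
    intervalIntegral.integral_congr fun t ht => hheq (hsub x hx ht)
  set H : ℝ → ℝ := fun x => ∫ t in (0 : ℝ)..x, hc t with hH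
  have hHd : ∀ x, HasDerivAt H (hc x) x := fun x => (hhc.integral_hasStrictDerivAt 0 x).hasDerivAt
  have hHc : Continuous H := continuous_iff_continuousAt.2 fun x => (hHd x).continuousAt
  have hH0 : H 0 = 0 := by simp [hH]
  have hHℓ : H ℓ = 0 := by
    have := hweak 1 (fun _ => 0) continuous_const
    simp only [intervalIntegral.integral_zero, mul_zero, add_zero, mul_one] at this
    rw [hHeq ℓ hℓm] at this
    exact this
  have hzero : ∀ x ∈ Icc 0 ℓ, zc x - H x - η = 0 := by
    set g : ℝ → ℝ := fun x => zc x - H x - η with hgdef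
    have hg : Continuous g := (hzc.sub hHc).sub continuous_const
    set G : ℝ → ℝ := fun x => ∫ t in (0 : ℝ)..x, g t with hG
    have hGd : ∀ x, HasDerivAt G (g x) x := fun x => (hg.integral_hasStrictDerivAt 0 x).hasDerivAt
    have h1 := hweak 0 g hg
    have h2 : ∫ x in (0 : ℝ)..ℓ, h x * (0 + ∫ t in (0 : ℝ)..x, g t)
        = ∫ x in (0 : ℝ)..ℓ, hc x * G x :=
      intervalIntegral.integral_congr fun x hx => by
        simp only [zero_add, hG]; rw [hheq (hsub ℓ hℓm hx)]
    have h3 : ∫ x in (0 : ℝ)..ℓ, z x * g x = ∫ x in (0 : ℝ)..ℓ, zc x * g x :=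
      intervalIntegral.integral_congr fun x hx => by
        rw [hzeq (hsub ℓ hℓm hx)]
    have h4 := intervalIntegral.integral_mul_deriv_eq_deriv_mul (a := 0) (b := ℓ)
      (u := H) (v := G) (u' := hc) (v' := g)
      (fun x _ => hHd x) (fun x _ => hGd x)
      (hhc.intervalIntegrable _ _) (hg.intervalIntegrable _ _)
    rw [hHℓ, hH0, zero_mul, zero_mul, sub_zero, zero_sub] at h4
    have h5 : ∫ x in (0 : ℝ)..ℓ, g x * g x = 0 := by
      have : ∀ x, g x * g x = zc x * g x - H x * g x - η * g x := fun x => by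
        simp only [hgdef]; ring
      simp_rw [this]
      have i1 : IntervalIntegrable (fun x => zc x * g x) volume 0 ℓ :=
        (hzc.mul hg).intervalIntegrable _ _
      have i2 : IntervalIntegrable (fun x => H x * g x) volume 0 ℓ :=
        (hHc.mul hg).intervalIntegrable _ _
      have i3 : IntervalIntegrable (fun x => η * g x) volume 0 ℓ :=
        (continuous_const.mul hg).intervalIntegrable _ _
      rw [intervalIntegral.integral_sub (i1.sub i2) i3, intervalIntegral.integral_sub i1 i2,
        intervalIntegral.integral_const_mul]
      rw [h2, h3] at h1
      linarith
    intro x hx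
    by_contra hne
    have : 0 < ∫ t in (0 : ℝ)..ℓ, g t * g t := intervalIntegral.integral_pos hℓ (hg.mul hg).continuousOn
      (fun t _ => mul_self_nonneg (g t)) ⟨x, hx, mul_self_pos.2 hne⟩
    linarith
  have main : ∀ x ∈ Icc 0 ℓ, z x = η + ∫ t in (0 : ℝ)..x, h t := fun x hx => by
    rw [hHeq x hx, hzeq hx]
    have := hzero x hx
    simp only [hH] at this
    linarith
  refine ⟨main, ?_⟩
  rw [main ℓ hℓm, hHeq ℓ hℓm]
  simp only [hH] at hHℓ
  rw [hHℓ, add_zero]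

lemma IntervalSobolev.sub_eq_integral {ℓ p : ℝ} {u u' : ℝ → ℝ} (hu : IntervalSobolev ℓ p u u')
    (hu' : ContinuousOn u' (Icc 0 ℓ)) {x y : ℝ} (hx : x ∈ Icc 0 ℓ) (hy : y ∈ Icc 0 ℓ) :
    u y - u x = ∫ t in x..y, u' t := by
  have hint : ∀ t ∈ Icc 0 ℓ, IntervalIntegrable u' volume 0 t := fun t ht =>
    (hu'.mono (by rw [uIcc_of_le ht.1]; exact Icc_subset_Icc le_rfl ht.2)).intervalIntegrable
  rw [hu.2.2 x hx, hu.2.2 y hy, ← intervalIntegral.integral_interval_sub_left (hint y hy) (hint x hx)]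
  ring

lemma IntervalSobolev.continuousOn {ℓ p : ℝ} {u u' : ℝ → ℝ} (hu : IntervalSobolev ℓ p u u')
    (hℓ : 0 ≤ ℓ) (hu' : ContinuousOn u' (Icc 0 ℓ)) : ContinuousOn u (Icc 0 ℓ) := by
  have h := intervalIntegral.continuousOn_primitive_interval (a := 0) (b := ℓ) (f := u')
    (μ := volume) (by rw [uIcc_of_le hℓ]; exact hu'.integrableOn_Icc)
  rw [uIcc_of_le hℓ] at h
  exact (continuousOn_const.add h).congr hu.2.2

/-- Comparison of two `C¹` solutions of Neumann problems whose fluxes at the endpoints differ by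
`-η` and `η`, with `η > 0`. -/
lemma SolvesNeumann.comparison {ℓ p : ℝ} (hℓ : 0 < ℓ) (hp : 1 < p) {γ f : ℝ → ℝ}
    (hγc : Continuous γ) (hγm : StrictMono γ) {a b η : ℝ} (hη : 0 < η)
    {u₁ u₁' u₂ u₂' : ℝ → ℝ}
    (h₁ : SolvesNeumann ℓ p γ f a b (fun x => γ (u₁ x)) u₁ u₁')
    (h₂ : SolvesNeumann ℓ p γ f (a - η) (b + η) (fun x => γ (u₂ x)) u₂ u₂')
    (hc₁ : ContinuousOn u₁' (Icc 0 ℓ)) (hc₂ : ContinuousOn u₂' (Icc 0 ℓ)) :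
    u₂ 0 < u₁ 0 ∧ u₁ ℓ < u₂ ℓ ∧ ∀ x ∈ Icc 0 ℓ, rho p (u₂' x) - rho p (u₁' x) ≤ η := by
  obtain ⟨-, hs₁, -, hw₁⟩ := h₁
  obtain ⟨-, hs₂, -, hw₂⟩ := h₂
  have hg₁ : ContinuousOn (fun x => γ (u₁ x)) (Icc 0 ℓ) :=
    hγc.comp_continuousOn (hs₁.continuousOn hℓ.le hc₁)
  have hg₂ : ContinuousOn (fun x => γ (u₂ x)) (Icc 0 ℓ) :=
    hγc.comp_continuousOn (hs₂.continuousOn hℓ.le hc₂)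
  have hr₁ : ContinuousOn (fun x => rho p (u₁' x)) (Icc 0 ℓ) :=
    (continuous_rho hp).comp_continuousOn hc₁
  have hr₂ : ContinuousOn (fun x => rho p (u₂' x)) (Icc 0 ℓ) :=
    (continuous_rho hp).comp_continuousOn hc₂
  have hint : ∀ g : ℝ → ℝ, ContinuousOn g (Icc 0 ℓ) → ∀ x ∈ Icc 0 ℓ, ∀ y ∈ Icc 0 ℓ,
      IntervalIntegrable g volume x y := fun g hg x hx y hy =>
    (hg.mono (uIcc_subset_Icc hx hy)).intervalIntegrable
  have h0m : (0 : ℝ) ∈ Icc 0 ℓ := ⟨le_rfl, hℓ.le⟩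
  have hℓm : ℓ ∈ Icc 0 ℓ := ⟨hℓ.le, le_rfl⟩
  have hh := hg₂.sub hg₁
  have hz := hr₂.sub hr₁
  obtain ⟨hzeq, hzℓ⟩ := eq_add_integral_of_weak (η := η) hℓ hz hh (by
    intro c g hg
    set φ : ℝ → ℝ := fun x => c + ∫ t in (0 : ℝ)..x, g t with hφ
    have hφc : Continuous φ := continuous_const.add
      (continuous_iff_continuousAt.2 fun x =>
        (hg.integral_hasStrictDerivAt 0 x).hasDerivAt.continuousAt)
    have hS : IntervalSobolev ℓ p φ g := intervalSobolev_primitive (by linarith) c hg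
    have e₁ := hw₁ φ g hS
    have e₂ := hw₂ φ g hS
    rw [integral_Ioo_eq_interval hℓ.le, integral_Ioo_eq_interval hℓ.le] at e₁ e₂
    have hφ0 : φ 0 = c := by simp [hφ]
    have hφℓ : φ ℓ = c + ∫ t in (0 : ℝ)..ℓ, g t := rfl
    have i₁ : ∫ x in (0 : ℝ)..ℓ, (γ (u₂ x) - γ (u₁ x)) * φ x =
        (∫ x in (0 : ℝ)..ℓ, γ (u₂ x) * φ x) - ∫ x in (0 : ℝ)..ℓ, γ (u₁ x) * φ x := by
      simp_rw [sub_mul]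
      exact intervalIntegral.integral_sub
        (hint _ (hg₂.mul hφc.continuousOn) 0 h0m ℓ hℓm)
        (hint _ (hg₁.mul hφc.continuousOn) 0 h0m ℓ hℓm)
    have i₂ : ∫ x in (0 : ℝ)..ℓ, (rho p (u₂' x) - rho p (u₁' x)) * g x =
        (∫ x in (0 : ℝ)..ℓ, rho p (u₂' x) * g x) - ∫ x in (0 : ℝ)..ℓ, rho p (u₁' x) * g x := by
      simp_rw [sub_mul]
      exact intervalIntegral.integral_sub
        (hint _ (hr₂.mul hg.continuousOn) 0 h0m ℓ hℓm)
        (hint _ (hr₁.mul hg.continuousOn) 0 h0m ℓ hℓm)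
    refine (congrArg₂ (· + ·) i₁ i₂).trans ?_
    rw [hφ0, hφℓ] at e₁ e₂
    linear_combination e₂ - e₁)
  have hz0 : rho p (u₂' 0) - rho p (u₁' 0) = η := by simpa using hzeq 0 h0m
  have hzℓ : rho p (u₂' ℓ) - rho p (u₁' ℓ) = η := hzℓ
  have hwd : ∀ x ∈ Icc 0 ℓ, ∀ y ∈ Icc 0 ℓ,
      (u₂ y - u₁ y) - (u₂ x - u₁ x) = ∫ t in x..y, (u₂' t - u₁' t) := fun x hx y hy => by
    rw [intervalIntegral.integral_sub (hint _ hc₂ x hx y hy) (hint _ hc₁ x hx y hy),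
      ← hs₂.sub_eq_integral hc₂ hx hy, ← hs₁.sub_eq_integral hc₁ hx hy]
    ring
  have hzh : ∀ x ∈ Icc 0 ℓ, ∀ y ∈ Icc 0 ℓ,
      (rho p (u₂' y) - rho p (u₁' y)) - (rho p (u₂' x) - rho p (u₁' x))
        = ∫ t in x..y, (γ (u₂ t) - γ (u₁ t)) := fun x hx y hy => by
    have e := intervalIntegral.integral_interval_sub_left (hint _ hh 0 h0m y hy)
      (hint _ hh 0 h0m x hx)
    have ex := hzeq x hx
    have ey := hzeq y hy
    simp only [Pi.sub_apply] at e ex ey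
    linarith
  have hdz : ∀ x ∈ Icc 0 ℓ, 0 < rho p (u₂' x) - rho p (u₁' x) → 0 < u₂' x - u₁' x :=
    fun x _ hx => sub_pos.2 ((strictMono_rho hp).lt_iff_lt.1 (sub_pos.1 hx))
  have hright : ∀ {x y : ℝ}, 0 ≤ x → x < y → y ≤ ℓ → 0 < rho p (u₂' x) - rho p (u₁' x) →
      0 ≤ u₂ x - u₁ x → rho p (u₂' x) - rho p (u₁' x) < rho p (u₂' y) - rho p (u₁' y) :=
    lt_of_cooperative_right (w := fun x => u₂ x - u₁ x)
      (z := fun x => rho p (u₂' x) - rho p (u₁' x)) (hc₂.sub hc₁) hh hz hwd hzh hdz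
      (fun x _ hx => sub_pos.2 (hγm (sub_pos.1 hx)))
  have hleft : ∀ {x y : ℝ}, 0 ≤ x → x < y → y ≤ ℓ → 0 < rho p (u₂' y) - rho p (u₁' y) →
      u₂ y - u₁ y ≤ 0 → rho p (u₂' y) - rho p (u₁' y) < rho p (u₂' x) - rho p (u₁' x) :=
    lt_of_cooperative_left (w := fun x => u₂ x - u₁ x)
      (z := fun x => rho p (u₂' x) - rho p (u₁' x)) (hc₂.sub hc₁) hh hz hwd hzh hdz
      (fun x _ hx => sub_neg.2 (hγm (sub_neg.1 hx)))
  refine ⟨?_, ?_, fun x hx => ?_⟩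
  · by_contra! hcon
    have := hright le_rfl hℓ le_rfl (by linarith) (by linarith)
    linarith
  · by_contra! hcon
    have := hleft le_rfl hℓ le_rfl (by linarith) (by linarith)
    linarith
  · by_contra! hcon
    rcases le_total 0 (u₂ x - u₁ x) with hw | hw
    · have hxℓ : x < ℓ := lt_of_le_of_ne hx.2 (by rintro rfl; linarith)
      have := hright hx.1 hxℓ le_rfl (by linarith) hw
      linarith
    · have hx0 : 0 < x := lt_of_le_of_ne hx.1 (by rintro rfl; linarith)
      have := hleft le_rfl hx0 hx.2 (by linarith) hw
      linarith

lemma exists_pos_le_rho_gap {ℓ p : ℝ} (hℓ : 0 ≤ ℓ) (hp : 1 < p) {v : ℝ → ℝ}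
    (hv : ContinuousOn v (Icc 0 ℓ)) {η : ℝ} (hη : 0 < η) :
    ∃ κ > 0, ∀ x ∈ Icc 0 ℓ,
      κ ≤ rho p (v x + η) - rho p (v x) ∧ κ ≤ rho p (v x) - rho p (v x - η) := by
  have hρ := continuous_rho hp
  have hm := strictMono_rho hp
  have hc : ContinuousOn
      (fun x => min (rho p (v x + η) - rho p (v x)) (rho p (v x) - rho p (v x - η))) (Icc 0 ℓ) := by
    fun_prop
  obtain ⟨x, -, hmin⟩ := isCompact_Icc.exists_isMinOn ⟨0, le_rfl, hℓ⟩ hc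
  refine ⟨min (rho p (v x + η) - rho p (v x)) (rho p (v x) - rho p (v x - η)),
    lt_min (sub_pos.2 (hm (by linarith))) (sub_pos.2 (hm (by linarith))), fun y hy => ?_⟩
  exact le_min_iff.1 (hmin hy)

/-- Lemma 3.1, point 3: for the solutions of (P^{γ,f}_{p,a−ε,b+ε}),
the endpoint values u_ε(ℓ) and u_ε(0) move strictly monotonically with ε at ε=0
and depend continuously on ε. -/
theorem neumann_perturbed_both_fluxes
    (ℓ : ℝ) (hℓ : 0 < ℓ) (p : ℝ) (hp : 1 < p)
    (γ : ℝ → ℝ) (hγc : Continuous γ) (hγm : StrictMono γ)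
    (hγs : Function.Surjective γ) (hγ0 : γ 0 = 0)
    (f : ℝ → ℝ) (hf : IntegrableOn f (Ioo 0 ℓ) volume) (a b : ℝ)
    (u u' : ℝ → ℝ → ℝ)
    (hsol : ∀ ε : ℝ,
      SolvesNeumann ℓ p γ f (a - ε) (b + ε) (fun x => γ (u ε x)) (u ε) (u' ε))
    (hC1 : ∀ ε : ℝ, ContinuousOn (u' ε) (Icc 0 ℓ)) :
    (∀ ε : ℝ, 0 < ε → u 0 ℓ < u ε ℓ ∧ u ε 0 < u 0 0) ∧
    (∀ ε : ℝ, ε < 0 → u ε ℓ < u 0 ℓ ∧ u 0 0 < u ε 0) ∧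
    Continuous (fun ε => u ε ℓ) ∧
    Continuous (fun ε => u ε 0) := by
  have hcmp : ∀ ε δ : ℝ, ε < δ → u δ 0 < u ε 0 ∧ u ε ℓ < u δ ℓ ∧
      ∀ x ∈ Icc 0 ℓ, rho p (u' δ x) - rho p (u' ε x) ≤ δ - ε := by
    intro ε δ h
    refine SolvesNeumann.comparison hℓ hp hγc hγm (sub_pos.2 h) (hsol ε) ?_ (hC1 ε) (hC1 δ)
    have := hsol δ
    rwa [show a - δ = a - ε - (δ - ε) by ring, show b + δ = b + ε + (δ - ε) by ring] at this
  have hbound : ∀ ε δ η : ℝ, (∀ x ∈ Icc 0 ℓ, u' δ x - u' ε x ≤ η) →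
      (u δ ℓ - u δ 0) - (u ε ℓ - u ε 0) ≤ ℓ * η := by
    intro ε δ η h
    have h0m : (0 : ℝ) ∈ Icc 0 ℓ := ⟨le_rfl, hℓ.le⟩
    have hℓm : ℓ ∈ Icc 0 ℓ := ⟨hℓ.le, le_rfl⟩
    have hint : ∀ ε, IntervalIntegrable (u' ε) volume 0 ℓ := fun ε =>
      ((hC1 ε).mono (uIcc_subset_Icc h0m hℓm)).intervalIntegrable
    rw [(hsol δ).2.1.sub_eq_integral (hC1 δ) h0m hℓm,
      (hsol ε).2.1.sub_eq_integral (hC1 ε) h0m hℓm,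
      ← intervalIntegral.integral_sub (hint δ) (hint ε)]
    refine (intervalIntegral.integral_mono_on hℓ.le ((hint δ).sub (hint ε))
      intervalIntegrable_const h).trans_eq ?_
    simp
  have hcont : ∀ ε r : ℝ, 0 < r → ∃ κ > 0, ∀ δ, |δ - ε| < κ →
      |u δ ℓ - u ε ℓ| < r ∧ |u δ 0 - u ε 0| < r := by
    intro ε r hr
    obtain ⟨κ, hκ, hgap⟩ := exists_pos_le_rho_gap hℓ.le hp (hC1 ε) (div_pos hr hℓ)
    have hmul : ℓ * (r / ℓ) = r := mul_div_cancel₀ r hℓ.ne'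
    refine ⟨κ, hκ, fun δ hδ => ?_⟩
    rw [abs_lt] at hδ
    rcases lt_trichotomy ε δ with h | rfl | h
    · obtain ⟨h0, h1, h2⟩ := hcmp ε δ h
      have := hbound ε δ (r / ℓ) fun x hx => by
        by_contra! hcon
        have := strictMono_rho hp (show u' ε x + r / ℓ < u' δ x by linarith)
        linarith [h2 x hx, (hgap x hx).1]
      constructor <;> rw [abs_lt] <;> constructor <;> linarith
    · simpa using hr
    · obtain ⟨h0, h1, h2⟩ := hcmp δ ε h
      have := hbound δ ε (r / ℓ) fun x hx => by
        by_contra! hcon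
        have := strictMono_rho hp (show u' δ x < u' ε x - r / ℓ by linarith)
        linarith [h2 x hx, (hgap x hx).2]
      constructor <;> rw [abs_lt] <;> constructor <;> linarith
  refine ⟨fun ε h => ⟨(hcmp 0 ε h).2.1, (hcmp 0 ε h).1⟩,
    fun ε h => ⟨(hcmp ε 0 h).2.1, (hcmp ε 0 h).1⟩, ?_, ?_⟩ <;>
  · refine Metric.continuous_iff.2 fun ε r hr => ?_
    obtain ⟨κ, hκ, h⟩ := hcont ε r hr
    refine ⟨κ, hκ, fun δ hδ => ?_⟩
    rw [Real.dist_eq] at hδ ⊢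
    first
      | exact (h δ hδ).1
      | exact (h δ hδ).2
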